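/- arXiv:1802.04000 — 9 statements merged into one kernel-verified Lean document; each statement's English description precedes it below -/
import Mathlib

section
/- Let ρ : [0,1] → ℝ be continuously differentiable with ρ(x) > 0 for all x ∈ [0,1] and ∫₀¹ ρ(x) dx = 1, let u : [0,1] → ℝ be continuously differentiable with u(0) = u(1) = 0, and let A > 0. Then E(ρ,u) ≥ (1/8) ∫₀¹ (ρ'(x))² / ρ(x)³ dx. -/
open MeasureTheory

/-- The entropy functional `H(ρ,u) = ∫₀¹ (½ ρ u² + A² ρ log ρ) dx`. -/
noncomputable def energyH (A : ℝ) (ρ u : ℝ → ℝ) : ℝ :=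
  ∫ x in (0:ℝ)..1, ((1 / 2) * ρ x * u x ^ 2 + A ^ 2 * ρ x * Real.log (ρ x))

/-- The modified energy
`E(ρ,u) = H(ρ,u) + ½ ∫₀¹ (ρ' u / ρ + ½ (ρ')² / ρ³) dx`. -/
noncomputable def energyE (A : ℝ) (ρ ρ' u : ℝ → ℝ) : ℝ :=
  energyH A ρ u +
    (1 / 2) * ∫ x in (0:ℝ)..1, (ρ' x * u x / ρ x + (1 / 2) * ρ' x ^ 2 / ρ x ^ 3)

/-- Pointwise lower bound for the modified energy density: completing the square in the velocity
leaves `q² / (8 r³)`, and `r log r ≥ r - 1` bounds the entropy. -/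
theorem energy_density_lower_bound (A q v : ℝ) {r : ℝ} (hr : 0 < r) :
    (1 / 8) * (q ^ 2 / r ^ 3) + A ^ 2 * (r - 1) ≤
      ((1 / 2) * r * v ^ 2 + A ^ 2 * r * Real.log r) +
        (1 / 2) * (q * v / r + (1 / 2) * q ^ 2 / r ^ 3) := by
  have hlog : r - 1 ≤ r * Real.log r := by
    have h := mul_le_mul_of_nonneg_left (Real.one_sub_inv_le_log_of_pos hr) hr.le
    rwa [mul_sub, mul_one, mul_inv_cancel₀ hr.ne'] at h
  have hentropy := mul_le_mul_of_nonneg_left hlog (sq_nonneg A)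
  have hsquare : (1 / 2) * r * v ^ 2 + (1 / 2) * (q * v / r + (1 / 2) * q ^ 2 / r ^ 3) -
      (1 / 8) * (q ^ 2 / r ^ 3) = (1 / 2) * r * (v + q / (2 * r ^ 2)) ^ 2 := by
    field_simp
    ring
  have hnonneg : 0 ≤ (1 / 2) * r * (v + q / (2 * r ^ 2)) ^ 2 := by positivity
  linarith

/-- If `ρ` is `C¹` on `[0,1]`, positive, with mass one, `u` is `C¹` with `u(0)=u(1)=0`,
and `A > 0`, then `E(ρ,u) ≥ (1/8) ∫₀¹ (ρ')²/ρ³ dx`. -/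
theorem energy_lower_bound (A : ℝ) (hA : 0 < A) (ρ ρ' u u' : ℝ → ℝ)
    (hρd : ∀ x ∈ Set.Icc (0:ℝ) 1, HasDerivAt ρ (ρ' x) x)
    (hρ'c : ContinuousOn ρ' (Set.Icc (0:ℝ) 1))
    (hρpos : ∀ x ∈ Set.Icc (0:ℝ) 1, 0 < ρ x)
    (hmass : ∫ x in (0:ℝ)..1, ρ x = 1)
    (hud : ∀ x ∈ Set.Icc (0:ℝ) 1, HasDerivAt u (u' x) x)
    (hu'c : ContinuousOn u' (Set.Icc (0:ℝ) 1))
    (hu0 : u 0 = 0) (hu1 : u 1 = 0) :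
    (1 / 8) * ∫ x in (0:ℝ)..1, ρ' x ^ 2 / ρ x ^ 3 ≤ energyE A ρ ρ' u := by
  have hρc : ContinuousOn ρ (Set.Icc 0 1) := fun x hx => (hρd x hx).continuousAt.continuousWithinAt
  have huc : ContinuousOn u (Set.Icc 0 1) := fun x hx => (hud x hx).continuousAt.continuousWithinAt
  have hne : ∀ x ∈ Set.Icc (0:ℝ) 1, ρ x ≠ 0 := fun x hx => (hρpos x hx).ne'
  have hne3 : ∀ x ∈ Set.Icc (0:ℝ) 1, ρ x ^ 3 ≠ 0 := fun x hx => pow_ne_zero 3 (hne x hx)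
  have integrable {f : ℝ → ℝ} (hf : ContinuousOn f (Set.Icc 0 1)) :
      IntervalIntegrable f volume 0 1 := hf.intervalIntegrable_of_Icc zero_le_one
  have hi₁ := integrable (f := fun x => ρ' x ^ 2 / ρ x ^ 3)
    ((hρ'c.pow 2).div (hρc.pow 3) hne3)
  have hi₂ := integrable (f := fun x => ρ x - 1) (hρc.sub continuousOn_const)
  have hi₃ := integrable
    (f := fun x => (1 / 2) * ρ x * u x ^ 2 + A ^ 2 * ρ x * Real.log (ρ x))
    (((continuousOn_const.mul hρc).mul (huc.pow 2)).add
      ((continuousOn_const.mul hρc).mul (hρc.log hne)))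
  have hi₄ := integrable
    (f := fun x => ρ' x * u x / ρ x + (1 / 2) * ρ' x ^ 2 / ρ x ^ 3)
    (((hρ'c.mul huc).div hρc hne).add
      ((continuousOn_const.mul (hρ'c.pow 2)).div (hρc.pow 3) hne3))
  have hmass_sub : ∫ x in (0:ℝ)..1, (ρ x - 1) = 0 := by
    rw [intervalIntegral.integral_sub (integrable hρc) (integrable continuousOn_const), hmass]
    simp
  have hmono := intervalIntegral.integral_mono_on zero_le_one
    ((hi₁.const_mul (1 / 8)).add (hi₂.const_mul (A ^ 2)))
    (hi₃.add (hi₄.const_mul (1 / 2)))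
    fun x hx => energy_density_lower_bound A (ρ' x) (u x) (hρpos x hx)
  rw [intervalIntegral.integral_add (hi₁.const_mul _) (hi₂.const_mul _),
    intervalIntegral.integral_add hi₃ (hi₄.const_mul _),
    intervalIntegral.integral_const_mul, intervalIntegral.integral_const_mul,
    intervalIntegral.integral_const_mul, hmass_sub, mul_zero, add_zero] at hmono
  exact hmono
end

section
/- Let ρ : [0,1] → ℝ be continuously differentiable with ρ(x) > 0 for all x ∈ [0,1] and ∫₀¹ ρ(x) dx = 1. Then for every x ∈ [0,1], |log ρ(x)| ≤ ( ∫₀¹ (ρ'(y))² / ρ(y)³ dy )^{1/2}. -/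
open MeasureTheory

/-- Weighted Cauchy–Schwarz: if `w > 0` has mass one on `[a, b]`, then `(∫ g)² ≤ ∫ g² / w`. -/
theorem sq_integral_le_integral_sq_div {g w : ℝ → ℝ} {a b : ℝ} (hab : a ≤ b)
    (hg : ContinuousOn g (Set.Icc a b))
    (hw : ContinuousOn w (Set.Icc a b)) (hpos : ∀ x ∈ Set.Icc a b, 0 < w x)
    (hmass : ∫ x in a..b, w x = 1) :
    (∫ x in a..b, g x) ^ 2 ≤ ∫ x in a..b, g x ^ 2 / w x := by
  set t := ∫ x in a..b, g x with ht
  have hgi := hg.intervalIntegrable_of_Icc (μ := volume) hab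
  have hwi := hw.intervalIntegrable_of_Icc (μ := volume) hab
  have hqi := ((hg.pow 2).div hw fun x hx => (hpos x hx).ne').intervalIntegrable_of_Icc
    (μ := volume) hab
  have hmono : ∫ x in a..b, (2 * t * g x - t ^ 2 * w x) ≤ ∫ x in a..b, g x ^ 2 / w x := by
    refine intervalIntegral.integral_mono_on hab
      ((hgi.const_mul _).sub (hwi.const_mul _)) hqi fun x hx => ?_
    rw [le_div_iff₀ (hpos x hx)]
    nlinarith [sq_nonneg (g x - t * w x)]
  rw [intervalIntegral.integral_sub (hgi.const_mul _) (hwi.const_mul _),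
    intervalIntegral.integral_const_mul, intervalIntegral.integral_const_mul, hmass, ← ht] at hmono
  linarith

/-- If `ρ` is `C¹` on `[0,1]`, positive, with mass one, then for every `x ∈ [0,1]`,
`|log ρ(x)| ≤ (∫₀¹ (ρ')²/ρ³ dy)^{1/2}`. -/
theorem log_density_bound (ρ ρ' : ℝ → ℝ)
    (hρd : ∀ x ∈ Set.Icc (0:ℝ) 1, HasDerivAt ρ (ρ' x) x)
    (hρ'c : ContinuousOn ρ' (Set.Icc (0:ℝ) 1))
    (hρpos : ∀ x ∈ Set.Icc (0:ℝ) 1, 0 < ρ x)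
    (hmass : ∫ x in (0:ℝ)..1, ρ x = 1) :
    ∀ x ∈ Set.Icc (0:ℝ) 1,
      |Real.log (ρ x)| ≤ Real.sqrt (∫ y in (0:ℝ)..1, ρ' y ^ 2 / ρ y ^ 3) := by
  intro x hx
  have hρc : ContinuousOn ρ (Set.Icc (0:ℝ) 1) := fun y hy =>
    (hρd y hy).continuousAt.continuousWithinAt
  obtain ⟨x₀, hx₀, hρx₀⟩ : ∃ x₀ ∈ Set.Icc (0:ℝ) 1, ρ x₀ = 1 := by
    obtain ⟨c, hc, hρc'⟩ := exists_eq_interval_average zero_ne_one (f := ρ)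
      (by rwa [Set.uIcc_of_le zero_le_one])
    rw [Set.uIoo_of_le zero_le_one] at hc
    exact ⟨c, Set.Ioo_subset_Icc_self hc, by rw [hρc', interval_average_eq_div, hmass]; norm_num⟩
  have hqc : ContinuousOn (fun y => ρ' y / ρ y) (Set.Icc (0:ℝ) 1) :=
    hρ'c.div hρc fun y hy => (hρpos y hy).ne'
  have hsub : Set.uIcc x₀ x ⊆ Set.Icc (0:ℝ) 1 := Set.uIcc_subset_Icc hx₀ hx
  have hlog : ∫ y in x₀..x, ρ' y / ρ y = Real.log (ρ x) := by
    rw [intervalIntegral.integral_eq_sub_of_hasDerivAt (f := fun y => Real.log (ρ y))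
      (fun y hy => (hρd y (hsub hy)).log (hρpos y (hsub hy)).ne')
      (hqc.mono hsub).intervalIntegrable, hρx₀, Real.log_one, sub_zero]
  have hint : |Real.log (ρ x)| ≤ ∫ y in (0:ℝ)..1, |ρ' y / ρ y| := by
    rw [← hlog, intervalIntegral.integral_of_le zero_le_one]
    refine (intervalIntegral.norm_integral_le_integral_norm_uIoc (f := fun y => ρ' y / ρ y)).trans ?_
    exact setIntegral_mono_set
      (hqc.abs.integrableOn_Icc.mono_set Set.Ioc_subset_Icc_self)
      (Filter.Eventually.of_forall fun y => abs_nonneg _)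
      (Set.Ioc_subset_Ioc (le_min hx₀.1 hx.1) (max_le hx₀.2 hx.2)).eventuallyLE
  have hcongr : ∫ y in (0:ℝ)..1, |ρ' y / ρ y| ^ 2 / ρ y = ∫ y in (0:ℝ)..1, ρ' y ^ 2 / ρ y ^ 3 := by
    refine intervalIntegral.integral_congr fun y _ => ?_
    simp only [sq_abs, div_pow, div_div, ← pow_succ]
  refine Real.le_sqrt_of_sq_le ?_
  rw [← hcongr]
  exact (pow_le_pow_left₀ (abs_nonneg _) hint 2).trans
    (sq_integral_le_integral_sq_div zero_le_one hqc.abs hρc hρpos hmass)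
end

section
/- Let ρ : [0,1] → ℝ be continuously differentiable with ρ(x) > 0 for all x ∈ [0,1] and ∫₀¹ ρ(x) dx = 1, let u : [0,1] → ℝ be continuously differentiable with u(0) = u(1) = 0, and let A > 0. Then for every x ∈ [0,1], exp(−(8·E(ρ,u))^{1/2}) ≤ ρ(x) ≤ exp((8·E(ρ,u))^{1/2}). -/
open MeasureTheory

/-- On `[0,1]`, the oscillation of `log ρ` is at most `∫₀¹ |ρ'| / ρ`. -/
theorem abs_log_sub_log_le_integral {ρ ρ' : ℝ → ℝ}
    (hρd : ∀ x ∈ Set.Icc (0:ℝ) 1, HasDerivAt ρ (ρ' x) x)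
    (hρ'c : ContinuousOn ρ' (Set.Icc (0:ℝ) 1))
    (hρpos : ∀ x ∈ Set.Icc (0:ℝ) 1, 0 < ρ x)
    {x y : ℝ} (hx : x ∈ Set.Icc (0:ℝ) 1) (hy : y ∈ Set.Icc (0:ℝ) 1) :
    |Real.log (ρ y) - Real.log (ρ x)| ≤ ∫ t in (0:ℝ)..1, |ρ' t| / ρ t := by
  have hρc : ContinuousOn ρ (Set.Icc (0:ℝ) 1) :=
    fun t ht => (hρd t ht).continuousAt.continuousWithinAt
  have hsub : Set.uIcc x y ⊆ Set.Icc (0:ℝ) 1 := Set.uIcc_subset_Icc hx hy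
  have hcont : ContinuousOn (fun t => ρ' t / ρ t) (Set.Icc (0:ℝ) 1) :=
    hρ'c.div hρc fun t ht => (hρpos t ht).ne'
  have hcont_abs : ContinuousOn (fun t => |ρ' t| / ρ t) (Set.Icc (0:ℝ) 1) :=
    hρ'c.abs.div hρc fun t ht => (hρpos t ht).ne'
  rw [← intervalIntegral.integral_eq_sub_of_hasDerivAt
    (fun t ht => (hρd t (hsub ht)).log (hρpos t (hsub ht)).ne')
    (hcont.mono hsub).intervalIntegrable]
  calc |∫ t in x..y, ρ' t / ρ t|
      ≤ |∫ t in x..y, (|ρ' t / ρ t|)| := by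
        simpa only [Real.norm_eq_abs] using
          intervalIntegral.norm_integral_le_abs_integral_norm (f := fun t => ρ' t / ρ t)
            (a := x) (b := y) (μ := volume)
    _ = |∫ t in x..y, |ρ' t| / ρ t| := by
        congr 1
        refine intervalIntegral.integral_congr fun t ht => ?_
        simp only [abs_div, abs_of_pos (hρpos t (hsub ht))]
    _ ≤ |∫ t in (0:ℝ)..1, |ρ' t| / ρ t| := by
        refine intervalIntegral.abs_integral_mono_interval ?_ ?_ ?_
        · rw [Set.uIoc_of_le zero_le_one, Set.uIoc]
          exact Set.Ioc_subset_Ioc (le_min hx.1 hy.1) (max_le hx.2 hy.2)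
        · rw [Set.uIoc_of_le zero_le_one]
          filter_upwards [ae_restrict_mem measurableSet_Ioc] with t ht
          exact div_nonneg (abs_nonneg _) (hρpos t (Set.Ioc_subset_Icc_self ht)).le
        · exact hcont_abs.intervalIntegrable_of_Icc zero_le_one
    _ = ∫ t in (0:ℝ)..1, |ρ' t| / ρ t :=
        abs_of_nonneg <| intervalIntegral.integral_nonneg zero_le_one fun t ht =>
          div_nonneg (abs_nonneg _) (hρpos t ht).le

/-- Pointwise lower bound for the density of the modified energy, combining a completed square
in the velocity, a completed square in `|ρ'|` and the tangent line of `r ↦ r log r` at `1`. -/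
theorem le_eight_mul_energy_density (A a d v : ℝ) {r : ℝ} (hr : 0 < r) :
    2 * a * (|d| / r) - a ^ 2 * r + 8 * A ^ 2 * (r - 1) ≤
      8 * (((1 / 2) * r * v ^ 2 + A ^ 2 * r * Real.log r) +
        (1 / 2) * (d * v / r + (1 / 2) * d ^ 2 / r ^ 3)) := by
  have hlog : r - 1 ≤ r * Real.log r := by
    have h := mul_le_mul_of_nonneg_left (Real.one_sub_inv_le_log_of_pos hr) hr.le
    rwa [mul_sub, mul_one, mul_inv_cancel₀ hr.ne'] at h
  have hlogA := mul_le_mul_of_nonneg_left hlog (sq_nonneg A)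
  have hsq : 0 ≤ (|d| - a * r ^ 2) ^ 2 / r ^ 3 := by positivity
  have hvel : 0 ≤ 4 * r * (v + d / (2 * r ^ 2)) ^ 2 := by positivity
  have hsq_eq : (|d| - a * r ^ 2) ^ 2 / r ^ 3 =
      d ^ 2 / r ^ 3 - 2 * a * (|d| / r) + a ^ 2 * r := by
    rw [← sq_abs d]
    field_simp
    ring
  have hvel_eq : 4 * r * (v + d / (2 * r ^ 2)) ^ 2 =
      4 * r * v ^ 2 + 4 * (d * v / r) + d ^ 2 / r ^ 3 := by
    field_simp
    ring
  have hassoc : (1 / 2) * d ^ 2 / r ^ 3 = (1 / 2) * (d ^ 2 / r ^ 3) := by ring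
  rw [hassoc]
  linarith

/-- For a density of unit mass, `(∫₀¹ |ρ'| / ρ)²` is at most eight times the modified energy. -/
theorem sq_integral_abs_div_le_energyE (A : ℝ) {ρ ρ' u : ℝ → ℝ}
    (hρc : ContinuousOn ρ (Set.Icc (0:ℝ) 1))
    (hρ'c : ContinuousOn ρ' (Set.Icc (0:ℝ) 1))
    (huc : ContinuousOn u (Set.Icc (0:ℝ) 1))
    (hρpos : ∀ x ∈ Set.Icc (0:ℝ) 1, 0 < ρ x)
    (hmass : ∫ x in (0:ℝ)..1, ρ x = 1) :
    (∫ t in (0:ℝ)..1, |ρ' t| / ρ t) ^ 2 ≤ 8 * energyE A ρ ρ' u := by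
  set a := ∫ t in (0:ℝ)..1, |ρ' t| / ρ t with ha
  have hne : ∀ t ∈ Set.Icc (0:ℝ) 1, ρ t ≠ 0 := fun t ht => (hρpos t ht).ne'
  have hint {f : ℝ → ℝ} (hf : ContinuousOn f (Set.Icc (0:ℝ) 1)) :
      IntervalIntegrable f volume 0 1 := hf.intervalIntegrable_of_Icc zero_le_one
  have hq := hint (f := fun t => |ρ' t| / ρ t) (hρ'c.abs.div hρc hne)
  have hρi := hint hρc
  have hH := hint (f := fun x => (1 / 2) * ρ x * u x ^ 2 + A ^ 2 * ρ x * Real.log (ρ x))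
    (((continuousOn_const.mul hρc).mul (huc.pow 2)).add
      ((continuousOn_const.mul hρc).mul (hρc.log hne)))
  have hG := hint (f := fun x => ρ' x * u x / ρ x + (1 / 2) * ρ' x ^ 2 / ρ x ^ 3)
    (((hρ'c.mul huc).div hρc hne).add
      ((continuousOn_const.mul (hρ'c.pow 2)).div (hρc.pow 3) fun t ht => pow_ne_zero 3 (hne t ht)))
  have hleft : ∫ t in (0:ℝ)..1,
      (2 * a * (|ρ' t| / ρ t) - a ^ 2 * ρ t + 8 * A ^ 2 * (ρ t - 1)) = a ^ 2 := by
    rw [intervalIntegral.integral_add ((hq.const_mul _).sub (hρi.const_mul _))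
        ((hρi.sub intervalIntegrable_const).const_mul _),
      intervalIntegral.integral_sub (hq.const_mul _) (hρi.const_mul _),
      intervalIntegral.integral_const_mul, intervalIntegral.integral_const_mul,
      intervalIntegral.integral_const_mul,
      intervalIntegral.integral_sub hρi intervalIntegrable_const, hmass, ← ha]
    simp
    ring
  rw [energyE, energyH, ← intervalIntegral.integral_const_mul,
    ← intervalIntegral.integral_add hH (hG.const_mul _),
    ← intervalIntegral.integral_const_mul, ← hleft]
  exact intervalIntegral.integral_mono_on zero_le_one
    (((hq.const_mul _).sub (hρi.const_mul _)).add
      ((hρi.sub intervalIntegrable_const).const_mul _))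
    ((hH.add (hG.const_mul _)).const_mul _)
    fun t ht => le_eight_mul_energy_density A a (ρ' t) (u t) (hρpos t ht)

/-- Pointwise bounds on the density in terms of the modified energy:
`exp(−√(8E(ρ,u))) ≤ ρ(x) ≤ exp(√(8E(ρ,u)))` on `[0,1]`. -/
theorem density_pointwise_bounds (A : ℝ) (hA : 0 < A) (ρ ρ' u u' : ℝ → ℝ)
    (hρd : ∀ x ∈ Set.Icc (0:ℝ) 1, HasDerivAt ρ (ρ' x) x)
    (hρ'c : ContinuousOn ρ' (Set.Icc (0:ℝ) 1))
    (hρpos : ∀ x ∈ Set.Icc (0:ℝ) 1, 0 < ρ x)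
    (hmass : ∫ x in (0:ℝ)..1, ρ x = 1)
    (hud : ∀ x ∈ Set.Icc (0:ℝ) 1, HasDerivAt u (u' x) x)
    (hu'c : ContinuousOn u' (Set.Icc (0:ℝ) 1))
    (hu0 : u 0 = 0) (hu1 : u 1 = 0) :
    ∀ x ∈ Set.Icc (0:ℝ) 1,
      Real.exp (-Real.sqrt (8 * energyE A ρ ρ' u)) ≤ ρ x ∧
        ρ x ≤ Real.exp (Real.sqrt (8 * energyE A ρ ρ' u)) := by
  have hρc : ContinuousOn ρ (Set.Icc (0:ℝ) 1) :=
    fun t ht => (hρd t ht).continuousAt.continuousWithinAt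
  have huc : ContinuousOn u (Set.Icc (0:ℝ) 1) :=
    fun t ht => (hud t ht).continuousAt.continuousWithinAt
  obtain ⟨c, hc, hρone⟩ : ∃ c ∈ Set.Icc (0:ℝ) 1, ρ c = 1 := by
    obtain ⟨c, hc, h⟩ := exists_eq_interval_average zero_ne_one
      (by rwa [Set.uIcc_of_le zero_le_one] : ContinuousOn ρ (Set.uIcc (0:ℝ) 1))
    refine ⟨c, ?_, ?_⟩
    · rw [Set.uIoo_of_le zero_le_one] at hc
      exact Set.Ioo_subset_Icc_self hc
    · rw [h, interval_average_eq, hmass]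
      simp
  intro x hx
  have hlog : |Real.log (ρ x)| ≤ Real.sqrt (8 * energyE A ρ ρ' u) := by
    have h := abs_log_sub_log_le_integral hρd hρ'c hρpos hc hx
    rw [hρone, Real.log_one, sub_zero] at h
    exact h.trans <| Real.le_sqrt_of_sq_le <|
      sq_integral_abs_div_le_energyE A hρc hρ'c huc hρpos hmass
  rw [← Real.le_log_iff_exp_le (hρpos x hx), ← Real.log_le_iff_le_exp (hρpos x hx)]
  exact abs_le.mp hlog
end

section
/- Let ρ : [0,1] → ℝ be continuously differentiable with ρ(x) > 0 for all x ∈ [0,1] and ∫₀¹ ρ(x) dx = 1, let u : [0,1] → ℝ be continuously differentiable with u(0) = u(1) = 0, and let A > 0. Then ∫₀¹ (ρ'(x))² dx ≤ 8·E(ρ,u)·exp(3·(8·E(ρ,u))^{1/2}). -/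
open MeasureTheory

/-- If `f'` is dominated by `g` on `[a, b]`, the oscillation of `f` is at most `∫ g`. -/
lemma sub_le_integral_of_abs_deriv_le {a b : ℝ} (hab : a ≤ b) {f f' g : ℝ → ℝ}
    (hf : ∀ x ∈ Set.Icc a b, HasDerivAt f (f' x) x)
    (hf' : ContinuousOn f' (Set.Icc a b)) (hg : ContinuousOn g (Set.Icc a b))
    (hfg : ∀ x ∈ Set.Icc a b, |f' x| ≤ g x) {x y : ℝ}
    (hx : x ∈ Set.Icc a b) (hy : y ∈ Set.Icc a b) :
    f y - f x ≤ ∫ t in a..b, g t := by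
  have hsub : Set.uIcc x y ⊆ Set.Icc a b := Set.uIcc_subset_Icc hx hy
  have hgi : IntervalIntegrable g volume a b := hg.intervalIntegrable_of_Icc hab
  have hg0 : ∀ t ∈ Set.Icc a b, 0 ≤ g t := fun t ht => (abs_nonneg _).trans (hfg t ht)
  have hftc : ∫ t in x..y, f' t = f y - f x :=
    intervalIntegral.integral_eq_sub_of_hasDerivAt (fun t ht => hf t (hsub ht))
      (hf'.mono hsub).intervalIntegrable
  have hnorm : ‖∫ t in x..y, f' t‖ ≤ |∫ t in x..y, g t| := by
    refine intervalIntegral.norm_integral_le_abs_of_norm_le ?_ (hg.mono hsub).intervalIntegrable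
    refine (ae_restrict_mem measurableSet_uIoc).mono fun t ht => ?_
    exact hfg t (hsub (Set.uIoc_subset_uIcc ht))
  have hmono : |∫ t in x..y, g t| ≤ |∫ t in a..b, g t| := by
    refine intervalIntegral.abs_integral_mono_interval ?_ ?_ hgi
    · rw [Set.uIoc_of_le hab]
      rintro t ⟨h₁, h₂⟩
      exact ⟨(le_inf hx.1 hy.1).trans_lt h₁, h₂.trans (sup_le hx.2 hy.2)⟩
    · refine (ae_restrict_mem measurableSet_uIoc).mono fun t ht => ?_
      rw [Set.uIoc_of_le hab] at ht
      exact hg0 t (Set.Ioc_subset_Icc_self ht)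
  rw [abs_of_nonneg (intervalIntegral.integral_nonneg hab hg0)] at hmono
  rw [← hftc]
  exact (le_abs_self _).trans (hnorm.trans hmono)

/-- A continuous function with integral `1` over `[0, 1]` is at most `1` somewhere. -/
lemma exists_le_one_of_integral_eq_one {ρ : ℝ → ℝ} (hρ : ContinuousOn ρ (Set.Icc 0 1))
    (hmass : ∫ x in (0:ℝ)..1, ρ x = 1) : ∃ x ∈ Set.Icc (0:ℝ) 1, ρ x ≤ 1 := by
  by_contra! h
  have hlt : ∫ _ in (0:ℝ)..1, (1:ℝ) < ∫ x in (0:ℝ)..1, ρ x :=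
    intervalIntegral.integral_lt_integral_of_continuousOn_of_le_of_exists_lt one_pos
      continuousOn_const hρ (fun x hx => (h x (Set.Ioc_subset_Icc_self hx)).le)
      ⟨0, by simp, h 0 (by simp)⟩
  simp [hmass] at hlt

/-- A positive density of mass one is bounded by `exp s` as soon as `∫ (ρ')² / ρ³ ≤ s²`. -/
lemma log_density_le {ρ ρ' : ℝ → ℝ} {s : ℝ} (hs : 0 < s)
    (hρd : ∀ x ∈ Set.Icc (0:ℝ) 1, HasDerivAt ρ (ρ' x) x)
    (hρ'c : ContinuousOn ρ' (Set.Icc (0:ℝ) 1))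
    (hρpos : ∀ x ∈ Set.Icc (0:ℝ) 1, 0 < ρ x)
    (hmass : ∫ x in (0:ℝ)..1, ρ x = 1)
    (hJ : ∫ x in (0:ℝ)..1, ρ' x ^ 2 / ρ x ^ 3 ≤ s ^ 2) {y : ℝ} (hy : y ∈ Set.Icc (0:ℝ) 1) :
    Real.log (ρ y) ≤ s := by
  have hρc : ContinuousOn ρ (Set.Icc (0:ℝ) 1) :=
    fun x hx => (hρd x hx).continuousAt.continuousWithinAt
  have hJc : ContinuousOn (fun x => ρ' x ^ 2 / ρ x ^ 3) (Set.Icc (0:ℝ) 1) :=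
    (hρ'c.pow 2).div (hρc.pow 3) fun x hx => (pow_pos (hρpos x hx) 3).ne'
  obtain ⟨x, hx, hx1⟩ := exists_le_one_of_integral_eq_one hρc hmass
  have hosc := sub_le_integral_of_abs_deriv_le (zero_le_one' ℝ) (f := fun t => Real.log (ρ t))
    (f' := fun t => ρ' t / ρ t)
    (g := fun t => (2 * s)⁻¹ * (ρ' t ^ 2 / ρ t ^ 3) + s / 2 * ρ t)
    (fun t ht => (hρd t ht).log (hρpos t ht).ne')
    (hρ'c.div hρc fun t ht => (hρpos t ht).ne')
    ((hJc.const_mul _).add (hρc.const_mul _))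
    (fun t ht => by
      have hp := hρpos t ht
      have hsq : (2 * s)⁻¹ * (ρ' t ^ 2 / ρ t ^ 3) + s / 2 * ρ t - |ρ' t| / ρ t
          = (|ρ' t| - s * ρ t ^ 2) ^ 2 / (2 * s * ρ t ^ 3) := by
        rw [← sq_abs (ρ' t)]
        field_simp
        ring
      have hnn : 0 ≤ (|ρ' t| - s * ρ t ^ 2) ^ 2 / (2 * s * ρ t ^ 3) := by positivity
      rw [abs_div, abs_of_pos hp]
      linarith) hx hy
  rw [intervalIntegral.integral_add
      ((hJc.const_mul _).intervalIntegrable_of_Icc zero_le_one)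
      ((hρc.const_mul _).intervalIntegrable_of_Icc zero_le_one),
    intervalIntegral.integral_const_mul, intervalIntegral.integral_const_mul, hmass] at hosc
  have hlog : Real.log (ρ x) ≤ 0 := Real.log_nonpos (hρpos x hx).le hx1
  have hJs : (2 * s)⁻¹ * ∫ x in (0:ℝ)..1, ρ' x ^ 2 / ρ x ^ 3 ≤ (2 * s)⁻¹ * s ^ 2 := by gcongr
  have hs2 : (2 * s)⁻¹ * s ^ 2 = s / 2 := by field_simp
  linarith

/-- The modified energy controls the weighted Dirichlet integral `∫ (ρ')² / ρ³`. -/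
lemma integral_sq_div_cube_le_energyE (A : ℝ) {ρ ρ' u : ℝ → ℝ}
    (hρc : ContinuousOn ρ (Set.Icc (0:ℝ) 1)) (hρ'c : ContinuousOn ρ' (Set.Icc (0:ℝ) 1))
    (huc : ContinuousOn u (Set.Icc (0:ℝ) 1))
    (hρpos : ∀ x ∈ Set.Icc (0:ℝ) 1, 0 < ρ x) (hmass : ∫ x in (0:ℝ)..1, ρ x = 1) :
    ∫ x in (0:ℝ)..1, ρ' x ^ 2 / ρ x ^ 3 ≤ 8 * energyE A ρ ρ' u := by
  have hne : ∀ x ∈ Set.Icc (0:ℝ) 1, ρ x ≠ 0 := fun x hx => (hρpos x hx).ne'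
  have hne3 : ∀ x ∈ Set.Icc (0:ℝ) 1, ρ x ^ 3 ≠ 0 := fun x hx => pow_ne_zero 3 (hne x hx)
  have hJc : ContinuousOn (fun x => ρ' x ^ 2 / ρ x ^ 3) (Set.Icc (0:ℝ) 1) :=
    (hρ'c.pow 2).div (hρc.pow 3) hne3
  have hHc : ContinuousOn
      (fun x => (1 / 2) * ρ x * u x ^ 2 + A ^ 2 * ρ x * Real.log (ρ x)) (Set.Icc (0:ℝ) 1) :=
    ((hρc.const_mul _).mul (huc.pow 2)).add ((hρc.const_mul _).mul (hρc.log hne))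
  have hMc : ContinuousOn
      (fun x => ρ' x * u x / ρ x + (1 / 2) * ρ' x ^ 2 / ρ x ^ 3) (Set.Icc (0:ℝ) 1) :=
    ((hρ'c.mul huc).div hρc hne).add (((hρ'c.pow 2).const_mul _).div (hρc.pow 3) hne3)
  have hρ1c : ContinuousOn (fun x => ρ x - 1) (Set.Icc (0:ℝ) 1) := hρc.sub continuousOn_const
  have hLc : ContinuousOn (fun x => (1 / 8) * (ρ' x ^ 2 / ρ x ^ 3) + A ^ 2 * (ρ x - 1))
      (Set.Icc (0:ℝ) 1) :=
    (hJc.const_mul _).add (hρ1c.const_mul _)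
  have hmono : ∫ x in (0:ℝ)..1, ((1 / 8) * (ρ' x ^ 2 / ρ x ^ 3) + A ^ 2 * (ρ x - 1)) ≤
      ∫ x in (0:ℝ)..1, (((1 / 2) * ρ x * u x ^ 2 + A ^ 2 * ρ x * Real.log (ρ x)) +
        (1 / 2) * (ρ' x * u x / ρ x + (1 / 2) * ρ' x ^ 2 / ρ x ^ 3)) := by
    refine intervalIntegral.integral_mono_on zero_le_one
      (hLc.intervalIntegrable_of_Icc zero_le_one)
      ((hHc.add (hMc.const_mul _)).intervalIntegrable_of_Icc zero_le_one) fun x hx => ?_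
    have hp := hρpos x hx
    have hlog : ρ x - 1 ≤ ρ x * Real.log (ρ x) := by
      have h := mul_le_mul_of_nonneg_left (Real.one_sub_inv_le_log_of_pos hp) hp.le
      rwa [mul_sub, mul_one, mul_inv_cancel₀ hp.ne'] at h
    have hA := mul_le_mul_of_nonneg_left hlog (sq_nonneg A)
    have hsq : (1 / 2) * ρ x * u x ^ 2 +
        (1 / 2) * (ρ' x * u x / ρ x + (1 / 2) * ρ' x ^ 2 / ρ x ^ 3) -
        (1 / 8) * (ρ' x ^ 2 / ρ x ^ 3) = (1 / 2) * ρ x * (u x + ρ' x / (2 * ρ x ^ 2)) ^ 2 := by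
      field_simp
      ring
    have hnn : 0 ≤ (1 / 2) * ρ x * (u x + ρ' x / (2 * ρ x ^ 2)) ^ 2 := by positivity
    linarith
  rw [intervalIntegral.integral_add (hHc.intervalIntegrable_of_Icc zero_le_one)
      ((hMc.const_mul _).intervalIntegrable_of_Icc zero_le_one),
    intervalIntegral.integral_add ((hJc.const_mul _).intervalIntegrable_of_Icc zero_le_one)
      ((hρ1c.const_mul _).intervalIntegrable_of_Icc zero_le_one),
    intervalIntegral.integral_const_mul, intervalIntegral.integral_const_mul,
    intervalIntegral.integral_const_mul,
    intervalIntegral.integral_sub (hρc.intervalIntegrable_of_Icc zero_le_one)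
      intervalIntegrable_const, hmass] at hmono
  simp only [intervalIntegral.integral_const, sub_zero, smul_eq_mul, mul_one, sub_self,
    mul_zero, add_zero] at hmono
  rw [energyE, energyH]
  linarith

/-- `∫₀¹ (ρ')² dx ≤ 8·E(ρ,u)·exp(3·√(8·E(ρ,u)))`. -/
theorem density_derivative_bound (A : ℝ) (hA : 0 < A) (ρ ρ' u u' : ℝ → ℝ)
    (hρd : ∀ x ∈ Set.Icc (0:ℝ) 1, HasDerivAt ρ (ρ' x) x)
    (hρ'c : ContinuousOn ρ' (Set.Icc (0:ℝ) 1))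
    (hρpos : ∀ x ∈ Set.Icc (0:ℝ) 1, 0 < ρ x)
    (hmass : ∫ x in (0:ℝ)..1, ρ x = 1)
    (hud : ∀ x ∈ Set.Icc (0:ℝ) 1, HasDerivAt u (u' x) x)
    (hu'c : ContinuousOn u' (Set.Icc (0:ℝ) 1))
    (hu0 : u 0 = 0) (hu1 : u 1 = 0) :
    ∫ x in (0:ℝ)..1, ρ' x ^ 2 ≤
      8 * energyE A ρ ρ' u * Real.exp (3 * Real.sqrt (8 * energyE A ρ ρ' u)) := by
  have hρc : ContinuousOn ρ (Set.Icc (0:ℝ) 1) :=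
    fun x hx => (hρd x hx).continuousAt.continuousWithinAt
  have huc : ContinuousOn u (Set.Icc (0:ℝ) 1) :=
    fun x hx => (hud x hx).continuousAt.continuousWithinAt
  have hJc : ContinuousOn (fun x => ρ' x ^ 2 / ρ x ^ 3) (Set.Icc (0:ℝ) 1) :=
    (hρ'c.pow 2).div (hρc.pow 3) fun x hx => (pow_pos (hρpos x hx) 3).ne'
  have hJE := integral_sq_div_cube_le_energyE A hρc hρ'c huc hρpos hmass
  set e := 8 * energyE A ρ ρ' u
  have hJ0 : 0 ≤ ∫ x in (0:ℝ)..1, ρ' x ^ 2 / ρ x ^ 3 :=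
    intervalIntegral.integral_nonneg zero_le_one fun x hx =>
      div_nonneg (sq_nonneg _) (pow_pos (hρpos x hx) 3).le
  have hlog : ∀ x ∈ Set.Icc (0:ℝ) 1, Real.log (ρ x) ≤ √e := fun x hx =>
    le_of_forall_gt_imp_ge_of_dense fun s hs =>
      log_density_le ((Real.sqrt_nonneg e).trans_lt hs) hρd hρ'c hρpos hmass
        (hJE.trans (Real.lt_sq_of_sqrt_lt hs).le) hx
  have hmono : ∫ x in (0:ℝ)..1, ρ' x ^ 2 ≤
      ∫ x in (0:ℝ)..1, (ρ' x ^ 2 / ρ x ^ 3) * Real.exp (3 * √e) := by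
    refine intervalIntegral.integral_mono_on zero_le_one
      ((hρ'c.pow 2).intervalIntegrable_of_Icc zero_le_one)
      ((hJc.mul continuousOn_const).intervalIntegrable_of_Icc zero_le_one) fun x hx => ?_
    have hp := hρpos x hx
    have hcube : ρ x ^ 3 ≤ Real.exp (3 * √e) := by
      have h := pow_le_pow_left₀ hp.le ((Real.log_le_iff_le_exp hp).1 (hlog x hx)) 3
      rwa [← Real.exp_nat_mul, Nat.cast_ofNat] at h
    calc ρ' x ^ 2 = ρ' x ^ 2 / ρ x ^ 3 * ρ x ^ 3 := by field_simp
      _ ≤ ρ' x ^ 2 / ρ x ^ 3 * Real.exp (3 * √e) := by gcongr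
  rw [intervalIntegral.integral_mul_const] at hmono
  exact hmono.trans (by gcongr)
end

section
/- Let ρ : [0,1] → ℝ be continuously differentiable with ρ(x) > 0 for all x ∈ [0,1] and ∫₀¹ ρ(x) dx = 1, let u : [0,1] → ℝ be continuously differentiable with u(0) = u(1) = 0, and let A > 0. Then ∫₀¹ u(x)² dx ≤ 2·H(ρ,u)·exp((8·E(ρ,u))^{1/2}). -/
open MeasureTheory

open Set in
/-- If `|ρ'| / ρ` is dominated by `g`, then `log ρ` oscillates by at most `∫ g` on `[0,1]`. -/
theorem abs_log_sub_log_le_integral_s6 {ρ ρ' g : ℝ → ℝ}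
    (hρd : ∀ x ∈ Icc (0:ℝ) 1, HasDerivAt ρ (ρ' x) x)
    (hρ'c : ContinuousOn ρ' (Icc (0:ℝ) 1))
    (hρpos : ∀ x ∈ Icc (0:ℝ) 1, 0 < ρ x)
    (hgc : ContinuousOn g (Icc (0:ℝ) 1))
    (hg : ∀ x ∈ Icc (0:ℝ) 1, |ρ' x / ρ x| ≤ g x)
    {a b : ℝ} (ha : a ∈ Icc (0:ℝ) 1) (hb : b ∈ Icc (0:ℝ) 1) :
    |Real.log (ρ b) - Real.log (ρ a)| ≤ ∫ x in (0:ℝ)..1, g x := by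
  wlog hab : a ≤ b generalizing a b
  · rw [abs_sub_comm]
    exact this hb ha (le_of_not_ge hab)
  have hsub : Icc a b ⊆ Icc (0:ℝ) 1 := Icc_subset_Icc ha.1 hb.2
  have hρc : ContinuousOn ρ (Icc (0:ℝ) 1) := fun x hx =>
    (hρd x hx).continuousAt.continuousWithinAt
  have hq : ContinuousOn (fun x => ρ' x / ρ x) (Icc (0:ℝ) 1) :=
    hρ'c.div hρc fun x hx => (hρpos x hx).ne'
  have hftc : ∫ x in a..b, ρ' x / ρ x = Real.log (ρ b) - Real.log (ρ a) := by
    refine intervalIntegral.integral_eq_sub_of_hasDerivAt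
      (f := fun x => Real.log (ρ x)) (fun x hx => ?_) ?_
    · rw [uIcc_of_le hab] at hx
      exact (hρd x (hsub hx)).log (hρpos x (hsub hx)).ne'
    · exact (hq.mono hsub).intervalIntegrable_of_Icc hab
  rw [← hftc, ← Real.norm_eq_abs]
  calc ‖∫ x in a..b, ρ' x / ρ x‖ ≤ ∫ x in a..b, g x := by
        refine intervalIntegral.norm_integral_le_of_norm_le hab ?_
          ((hgc.mono hsub).intervalIntegrable_of_Icc hab)
        exact Filter.Eventually.of_forall fun x hx => hg x (hsub (Ioc_subset_Icc_self hx))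
    _ ≤ ∫ x in (0:ℝ)..1, g x := by
        refine intervalIntegral.integral_mono_interval ha.1 hab hb.2 ?_
          (hgc.intervalIntegrable_of_Icc zero_le_one)
        refine (ae_restrict_iff' measurableSet_Ioc).2 (Filter.Eventually.of_forall fun x hx => ?_)
        exact (abs_nonneg _).trans (hg x (Ioc_subset_Icc_self hx))

/-- Young's inequality for `|ρ'| / ρ = (|ρ'| / ρ ^ (3/2)) * ρ ^ (1/2)`. -/
theorem abs_div_le_young {r p t : ℝ} (hr : 0 < r) (ht : 0 < t) :
    |p / r| ≤ 1 / 2 * (p ^ 2 / r ^ 3 * t⁻¹ + t * r) := by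
  have h : 1 / 2 * (p ^ 2 / r ^ 3 * t⁻¹ + t * r) - |p / r|
      = (|p| - t * r ^ 2) ^ 2 / (2 * r ^ 3 * t) := by
    rw [abs_div, abs_of_pos hr, ← sq_abs p]
    field_simp
    ring
  have : 0 ≤ (|p| - t * r ^ 2) ^ 2 / (2 * r ^ 3 * t) := by positivity
  linarith

theorem sub_one_le_mul_log {r : ℝ} (hr : 0 < r) : r - 1 ≤ r * Real.log r := by
  have h := mul_le_mul_of_nonneg_left (Real.one_sub_inv_le_log_of_pos hr) hr.le
  rwa [mul_sub, mul_inv_cancel₀ hr.ne', mul_one] at h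

/-- Completing the square in the kinetic part of the modified energy density. -/
theorem sq_div_cube_le_kinetic {r p v : ℝ} (hr : 0 < r) :
    1 / 8 * (p ^ 2 / r ^ 3) ≤
      1 / 2 * r * v ^ 2 + 1 / 2 * (p * v / r + 1 / 2 * p ^ 2 / r ^ 3) := by
  have h : 1 / 2 * r * v ^ 2 + 1 / 2 * (p * v / r + 1 / 2 * p ^ 2 / r ^ 3)
      - 1 / 8 * (p ^ 2 / r ^ 3) = (2 * r ^ 2 * v + p) ^ 2 / (8 * r ^ 3) := by
    field_simp
    ring
  have : 0 ≤ (2 * r ^ 2 * v + p) ^ 2 / (8 * r ^ 3) := by positivity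
  linarith

/-- `∫₀¹ u² dx ≤ 2·H(ρ,u)·exp(√(8·E(ρ,u)))`. -/
theorem velocity_L2_bound (A : ℝ) (hA : 0 < A) (ρ ρ' u u' : ℝ → ℝ)
    (hρd : ∀ x ∈ Set.Icc (0:ℝ) 1, HasDerivAt ρ (ρ' x) x)
    (hρ'c : ContinuousOn ρ' (Set.Icc (0:ℝ) 1))
    (hρpos : ∀ x ∈ Set.Icc (0:ℝ) 1, 0 < ρ x)
    (hmass : ∫ x in (0:ℝ)..1, ρ x = 1)
    (hud : ∀ x ∈ Set.Icc (0:ℝ) 1, HasDerivAt u (u' x) x)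
    (hu'c : ContinuousOn u' (Set.Icc (0:ℝ) 1))
    (hu0 : u 0 = 0) (hu1 : u 1 = 0) :
    ∫ x in (0:ℝ)..1, u x ^ 2 ≤
      2 * energyH A ρ u * Real.exp (Real.sqrt (8 * energyE A ρ ρ' u)) := by
  have h01 : (0:ℝ) ≤ 1 := zero_le_one
  have hρc : ContinuousOn ρ (Set.Icc (0:ℝ) 1) := fun x hx =>
    (hρd x hx).continuousAt.continuousWithinAt
  have huc : ContinuousOn u (Set.Icc (0:ℝ) 1) := fun x hx =>
    (hud x hx).continuousAt.continuousWithinAt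
  have hρ0 : ∀ x ∈ Set.Icc (0:ℝ) 1, ρ x ≠ 0 := fun x hx => (hρpos x hx).ne'
  have hρ30 : ∀ x ∈ Set.Icc (0:ℝ) 1, ρ x ^ 3 ≠ 0 := fun x hx => pow_ne_zero 3 (hρ0 x hx)
  have hlogc : ContinuousOn (fun x => Real.log (ρ x)) (Set.Icc (0:ℝ) 1) := hρc.log hρ0
  have hFc : ContinuousOn (fun x => ρ' x ^ 2 / ρ x ^ 3) (Set.Icc (0:ℝ) 1) :=
    (hρ'c.pow 2).div (hρc.pow 3) hρ30
  have hHc : ContinuousOn (fun x => (1 / 2) * ρ x * u x ^ 2 + A ^ 2 * ρ x * Real.log (ρ x))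
      (Set.Icc (0:ℝ) 1) := by fun_prop
  have hCc : ContinuousOn (fun x => ρ' x * u x / ρ x + (1 / 2) * ρ' x ^ 2 / ρ x ^ 3)
      (Set.Icc (0:ℝ) 1) :=
    ((hρ'c.mul huc).div hρc hρ0).add
      ((continuousOn_const.mul (hρ'c.pow 2)).div (hρc.pow 3) hρ30)
  have hρi := hρc.intervalIntegrable_of_Icc (μ := volume) h01
  have hFi := hFc.intervalIntegrable_of_Icc (μ := volume) h01
  have hHi := hHc.intervalIntegrable_of_Icc (μ := volume) h01
  have hCi := hCc.intervalIntegrable_of_Icc (μ := volume) h01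
  have hu2i : IntervalIntegrable (fun x => u x ^ 2) volume 0 1 :=
    (huc.pow 2).intervalIntegrable_of_Icc h01
  have hdev : ∫ x in (0:ℝ)..1, A ^ 2 * (ρ x - 1) = 0 := by
    rw [intervalIntegral.integral_const_mul,
      intervalIntegral.integral_sub hρi intervalIntegrable_const, hmass]
    simp
  have hdevi : IntervalIntegrable (fun x => A ^ 2 * (ρ x - 1)) volume 0 1 :=
    (hρi.sub intervalIntegrable_const).const_mul _
  have hent : ∀ x ∈ Set.Icc (0:ℝ) 1, A ^ 2 * (ρ x - 1) ≤ A ^ 2 * ρ x * Real.log (ρ x) :=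
    fun x hx => by
      rw [mul_assoc]
      exact mul_le_mul_of_nonneg_left (sub_one_le_mul_log (hρpos x hx)) (sq_nonneg A)
  have hE : ∫ x in (0:ℝ)..1, ρ' x ^ 2 / ρ x ^ 3 ≤ 8 * energyE A ρ ρ' u := by
    have hle : ∫ x in (0:ℝ)..1, (1 / 8 * (ρ' x ^ 2 / ρ x ^ 3) + A ^ 2 * (ρ x - 1)) ≤
        ∫ x in (0:ℝ)..1, (((1 / 2) * ρ x * u x ^ 2 + A ^ 2 * ρ x * Real.log (ρ x)) +
          1 / 2 * (ρ' x * u x / ρ x + (1 / 2) * ρ' x ^ 2 / ρ x ^ 3)) :=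
      intervalIntegral.integral_mono_on h01 ((hFi.const_mul _).add hdevi)
        (hHi.add (hCi.const_mul _)) fun x hx => by
          have h₁ := sq_div_cube_le_kinetic (p := ρ' x) (v := u x) (hρpos x hx)
          have h₂ := hent x hx
          linarith
    rw [intervalIntegral.integral_add (hFi.const_mul _) hdevi,
      intervalIntegral.integral_add hHi (hCi.const_mul _), hdev,
      intervalIntegral.integral_const_mul, intervalIntegral.integral_const_mul] at hle
    unfold energyE energyH
    linarith
  have hlog : ∀ x ∈ Set.Icc (0:ℝ) 1,
      -Real.log (ρ x) ≤ Real.sqrt (8 * energyE A ρ ρ' u) := by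
    obtain ⟨ξ, hξ, hmax⟩ := isCompact_Icc.exists_isMaxOn (Set.nonempty_Icc.2 h01) hρc
    have hξ1 : 1 ≤ ρ ξ := by
      have h := intervalIntegral.integral_mono_on h01 hρi
        (intervalIntegrable_const (c := ρ ξ)) fun x hx => hmax hx
      rw [hmass] at h
      simpa using h
    intro x hx
    refine le_of_forall_gt_imp_ge_of_dense fun t ht => ?_
    have ht0 : 0 < t := (Real.sqrt_nonneg _).trans_lt ht
    have htK : 8 * energyE A ρ ρ' u ≤ t ^ 2 := ((Real.sqrt_lt' ht0).1 ht).le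
    have hosc := abs_log_sub_log_le_integral_s6 hρd hρ'c hρpos
      (g := fun x => 1 / 2 * (ρ' x ^ 2 / ρ x ^ 3 * t⁻¹ + t * ρ x)) (by fun_prop)
      (fun y hy => abs_div_le_young (hρpos y hy) ht0) hx hξ
    rw [intervalIntegral.integral_const_mul,
      intervalIntegral.integral_add (hFi.mul_const _) (hρi.const_mul _),
      intervalIntegral.integral_mul_const, intervalIntegral.integral_const_mul, hmass] at hosc
    have hKt : (∫ x in (0:ℝ)..1, ρ' x ^ 2 / ρ x ^ 3) * t⁻¹ ≤ t := by
      rw [← div_eq_mul_inv, div_le_iff₀ ht0, ← sq]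
      exact hE.trans htK
    have h₁ := (le_abs_self _).trans hosc
    have h₂ := Real.log_nonneg hξ1
    linarith
  set M := Real.exp (Real.sqrt (8 * energyE A ρ ρ' u)) with hM
  have hM0 : 0 ≤ M := (Real.exp_pos _).le
  have hρM : ∀ x ∈ Set.Icc (0:ℝ) 1, 1 ≤ ρ x * M := fun x hx => by
    rw [← Real.exp_log (hρpos x hx), hM, ← Real.exp_add]
    exact Real.one_le_exp (by linarith [hlog x hx])
  have hle : ∫ x in (0:ℝ)..1, (u x ^ 2 + 2 * M * (A ^ 2 * (ρ x - 1))) ≤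
      ∫ x in (0:ℝ)..1, 2 * M * ((1 / 2) * ρ x * u x ^ 2 + A ^ 2 * ρ x * Real.log (ρ x)) :=
    intervalIntegral.integral_mono_on h01 (hu2i.add (hdevi.const_mul _)) (hHi.const_mul _)
      fun x hx => by
        have h₁ := mul_le_mul_of_nonneg_left (hent x hx) (mul_nonneg zero_le_two hM0)
        have h₂ := mul_le_mul_of_nonneg_right (hρM x hx) (sq_nonneg (u x))
        linarith
  rw [intervalIntegral.integral_add hu2i (hdevi.const_mul _),
    intervalIntegral.integral_const_mul, hdev, intervalIntegral.integral_const_mul] at hle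
  unfold energyH
  linarith
end

section
/- Let R ≥ 1, let ρ : [0,1] → ℝ be continuously differentiable with ρ(x) > 0 for all x ∈ [0,1] and ∫₀¹ ρ(x) dx = 1, and let u : [0,1] → ℝ be continuously differentiable with u(0) = u(1) = 0. If ∫₀¹ (u'(x))² dx + ∫₀¹ (ρ'(x))²/ρ(x)² dx ≤ R², then ∫₀¹ (ρ'(x))² dx + ∫₀¹ (u'(x))² dx + sup_{x∈[0,1]} ρ(x) + sup_{x∈[0,1]} 1/ρ(x) ≤ 4R²·e^{2R}. -/
open MeasureTheory

/-- On the unit interval, `∫ |f| ≤ R` whenever `∫ f² ≤ R²`. -/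
lemma integral_abs_le_of_integral_sq_le {f : ℝ → ℝ} {R : ℝ} (hR : 0 < R)
    (hf : ContinuousOn f (Set.Icc (0:ℝ) 1)) (h : ∫ x in (0:ℝ)..1, f x ^ 2 ≤ R ^ 2) :
    ∫ x in (0:ℝ)..1, |f x| ≤ R := by
  have hf' : ContinuousOn f (Set.uIcc (0:ℝ) 1) := by rwa [Set.uIcc_of_le zero_le_one]
  have hsq : IntervalIntegrable (fun x => f x ^ 2) volume 0 1 := (hf'.pow 2).intervalIntegrable
  have hmono : ∫ x in (0:ℝ)..1, |f x| ≤ ∫ x in (0:ℝ)..1, ((2 * R)⁻¹ * f x ^ 2 + R / 2) := by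
    refine intervalIntegral.integral_mono_on zero_le_one hf'.abs.intervalIntegrable
      ((hsq.const_mul _).add intervalIntegrable_const) fun x _ => ?_
    have key : (2 * R)⁻¹ * f x ^ 2 + R / 2 - |f x| = (2 * R)⁻¹ * (|f x| - R) ^ 2 := by
      rw [← sq_abs (f x)]
      field_simp
      ring
    have : 0 ≤ (2 * R)⁻¹ * (|f x| - R) ^ 2 := by positivity
    linarith
  rw [intervalIntegral.integral_add (hsq.const_mul _) intervalIntegrable_const,
    intervalIntegral.integral_const_mul, intervalIntegral.integral_const] at hmono
  have hle : (2 * R)⁻¹ * ∫ x in (0:ℝ)..1, f x ^ 2 ≤ (2 * R)⁻¹ * R ^ 2 := by gcongr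
  have heq : (2 * R)⁻¹ * R ^ 2 = R / 2 := by field_simp
  simp only [sub_zero, one_smul] at hmono
  linarith

/-- Harnack-type inequality: a positive function whose logarithmic derivative has `L²` norm at most
`R` on the unit interval has values comparable up to the factor `exp R`. -/
lemma le_exp_mul_of_integral_logDeriv_sq_le {ρ ρ' : ℝ → ℝ} {R : ℝ} (hR : 0 < R)
    (hρd : ∀ x ∈ Set.Icc (0:ℝ) 1, HasDerivAt ρ (ρ' x) x)
    (hρ'c : ContinuousOn ρ' (Set.Icc (0:ℝ) 1))
    (hρpos : ∀ x ∈ Set.Icc (0:ℝ) 1, 0 < ρ x)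
    (h : ∫ x in (0:ℝ)..1, (ρ' x / ρ x) ^ 2 ≤ R ^ 2)
    {x y : ℝ} (hx : x ∈ Set.Icc (0:ℝ) 1) (hy : y ∈ Set.Icc (0:ℝ) 1) :
    ρ x ≤ Real.exp R * ρ y := by
  have hρc : ContinuousOn ρ (Set.Icc (0:ℝ) 1) := fun z hz =>
    (hρd z hz).continuousAt.continuousWithinAt
  have hc : ContinuousOn (fun z => ρ' z / ρ z) (Set.Icc (0:ℝ) 1) :=
    hρ'c.div hρc fun z hz => (hρpos z hz).ne'
  have hsub : Set.uIcc y x ⊆ Set.Icc (0:ℝ) 1 := Set.uIcc_subset_Icc hy hx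
  have hlog : ∫ z in y..x, ρ' z / ρ z = Real.log (ρ x) - Real.log (ρ y) :=
    intervalIntegral.integral_eq_sub_of_hasDerivAt
      (fun z hz => (hρd z (hsub hz)).log (hρpos z (hsub hz)).ne')
      (hc.mono hsub).intervalIntegrable
  have hint : IntervalIntegrable (fun z => |ρ' z / ρ z|) volume 0 1 := by
    refine ContinuousOn.intervalIntegrable ?_
    rw [Set.uIcc_of_le zero_le_one]
    exact hc.abs
  have hnn : 0 ≤ ∫ z in (0:ℝ)..1, |ρ' z / ρ z| :=
    intervalIntegral.integral_nonneg zero_le_one fun _ _ => abs_nonneg _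
  have hbound : Real.log (ρ x) - Real.log (ρ y) ≤ R := calc
    Real.log (ρ x) - Real.log (ρ y) ≤ |∫ z in y..x, ρ' z / ρ z| := hlog ▸ le_abs_self _
    _ ≤ abs (∫ z in y..x, |ρ' z / ρ z|) := by
      simpa only [Real.norm_eq_abs] using intervalIntegral.norm_integral_le_abs_integral_norm
        (μ := volume) (a := y) (b := x) (f := fun z => ρ' z / ρ z)
    _ ≤ abs (∫ z in (0:ℝ)..1, |ρ' z / ρ z|) := by
      refine intervalIntegral.abs_integral_mono_interval ?_
        (Filter.Eventually.of_forall fun _ => abs_nonneg _) hint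
      rw [Set.uIoc_of_le zero_le_one]
      exact Set.Ioc_subset_Ioc (le_min hy.1 hx.1) (max_le hy.2 hx.2)
    _ = ∫ z in (0:ℝ)..1, |ρ' z / ρ z| := abs_of_nonneg hnn
    _ ≤ R := integral_abs_le_of_integral_sq_le hR hc h
  rw [← Real.exp_log (hρpos x hx), ← Real.exp_log (hρpos y hy), ← Real.exp_add]
  exact Real.exp_le_exp.mpr (by linarith)

/-- The inclusion `K_R ⊆ C_{S_R}` with `S_R = 4R²e^{2R}`: a bound on
`∫₀¹ u'² + ∫₀¹ (ρ'/ρ)²` yields bounds on `∫₀¹ ρ'²`, `∫₀¹ u'²`, `sup ρ` and `sup ρ⁻¹`. -/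
theorem KR_subset_CSR (R : ℝ) (hR : 1 ≤ R) (ρ ρ' u u' : ℝ → ℝ)
    (hρd : ∀ x ∈ Set.Icc (0:ℝ) 1, HasDerivAt ρ (ρ' x) x)
    (hρ'c : ContinuousOn ρ' (Set.Icc (0:ℝ) 1))
    (hρpos : ∀ x ∈ Set.Icc (0:ℝ) 1, 0 < ρ x)
    (hmass : ∫ x in (0:ℝ)..1, ρ x = 1)
    (hud : ∀ x ∈ Set.Icc (0:ℝ) 1, HasDerivAt u (u' x) x)
    (hu'c : ContinuousOn u' (Set.Icc (0:ℝ) 1))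
    (hu0 : u 0 = 0) (hu1 : u 1 = 0)
    (hKR : (∫ x in (0:ℝ)..1, u' x ^ 2) + ∫ x in (0:ℝ)..1, ρ' x ^ 2 / ρ x ^ 2 ≤ R ^ 2) :
    (∫ x in (0:ℝ)..1, ρ' x ^ 2) + (∫ x in (0:ℝ)..1, u' x ^ 2) +
        (⨆ x : Set.Icc (0:ℝ) 1, ρ ↑x) + (⨆ x : Set.Icc (0:ℝ) 1, 1 / ρ ↑x) ≤
      4 * R ^ 2 * Real.exp (2 * R) := by
  have hR0 : 0 < R := by linarith
  have hρc : ContinuousOn ρ (Set.uIcc (0:ℝ) 1) := by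
    rw [Set.uIcc_of_le zero_le_one]
    exact fun z hz => (hρd z hz).continuousAt.continuousWithinAt
  have hρint : IntervalIntegrable ρ volume 0 1 := hρc.intervalIntegrable
  have hρ'c' : ContinuousOn ρ' (Set.uIcc (0:ℝ) 1) := by rwa [Set.uIcc_of_le zero_le_one]
  have hne : ∀ z ∈ Set.uIcc (0:ℝ) 1, ρ z ^ 2 ≠ 0 := fun z hz =>
    pow_ne_zero 2 (hρpos z (by rwa [Set.uIcc_of_le zero_le_one] at hz)).ne'
  have hqint : IntervalIntegrable (fun x => ρ' x ^ 2 / ρ x ^ 2) volume 0 1 :=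
    ((hρ'c'.pow 2).div (hρc.pow 2) hne).intervalIntegrable
  have hU : 0 ≤ ∫ x in (0:ℝ)..1, u' x ^ 2 :=
    intervalIntegral.integral_nonneg zero_le_one fun _ _ => sq_nonneg _
  have hharnack : ∀ x ∈ Set.Icc (0:ℝ) 1, ∀ y ∈ Set.Icc (0:ℝ) 1, ρ x ≤ Real.exp R * ρ y :=
    fun x hx y hy => le_exp_mul_of_integral_logDeriv_sq_le hR0 hρd hρ'c hρpos
      (by simp only [div_pow]; linarith) hx hy
  have hupper : ∀ x ∈ Set.Icc (0:ℝ) 1, ρ x ≤ Real.exp R := fun x hx => by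
    have := intervalIntegral.integral_mono_on zero_le_one intervalIntegrable_const
      (hρint.const_mul (Real.exp R)) fun y hy => hharnack x hx y hy
    simpa [hmass] using this
  have hlower : ∀ y ∈ Set.Icc (0:ℝ) 1, 1 / ρ y ≤ Real.exp R := fun y hy => by
    have := intervalIntegral.integral_mono_on zero_le_one hρint
      intervalIntegrable_const fun x hx => hharnack x hx y hy
    rw [div_le_iff₀ (hρpos y hy)]
    simpa [hmass] using this
  have hsup : (⨆ x : Set.Icc (0:ℝ) 1, ρ ↑x) ≤ Real.exp R := ciSup_le fun x => hupper x x.2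
  have hsup' : (⨆ x : Set.Icc (0:ℝ) 1, 1 / ρ ↑x) ≤ Real.exp R := ciSup_le fun x => hlower x x.2
  have hexp : Real.exp (2 * R) = Real.exp R ^ 2 := by rw [← Real.exp_nat_mul]; norm_num
  have hderiv : ∫ x in (0:ℝ)..1, ρ' x ^ 2 ≤
      Real.exp R ^ 2 * ∫ x in (0:ℝ)..1, ρ' x ^ 2 / ρ x ^ 2 := by
    rw [← intervalIntegral.integral_const_mul]
    refine intervalIntegral.integral_mono_on zero_le_one (hρ'c'.pow 2).intervalIntegrable
      (hqint.const_mul _) fun x hx => ?_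
    have hpos := hρpos x hx
    calc ρ' x ^ 2 = ρ x ^ 2 * (ρ' x ^ 2 / ρ x ^ 2) := by field_simp
      _ ≤ Real.exp R ^ 2 * (ρ' x ^ 2 / ρ x ^ 2) := by
        gcongr
        exact hupper x hx
  have hE : 1 ≤ Real.exp R := Real.one_le_exp hR0.le
  have hE2 : Real.exp R ≤ Real.exp R ^ 2 := le_self_pow₀ hE two_ne_zero
  have hR2 : 1 ≤ R ^ 2 := one_le_pow₀ hR
  have hKR' := mul_le_mul_of_nonneg_left hKR (sq_nonneg (Real.exp R))
  have hU' := mul_le_mul_of_nonneg_right (hE.trans hE2) hU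
  have hER := mul_le_mul_of_nonneg_left hR2 (sq_nonneg (Real.exp R))
  have hER0 : 0 ≤ Real.exp R ^ 2 * R ^ 2 := by positivity
  rw [hexp]
  linarith
end

section
/- Let ρ, r : [0,1] → ℝ be continuous with ρ(x) > 0 and r(x) > 0 for all x, ∫₀¹ ρ dx = ∫₀¹ r dx = 1, let u, v : [0,1] → ℝ be continuous, and let A > 0. Set m = min{ inf_{x} ρ(x), 1/max( sup_{x} ρ(x), sup_{x} r(x) ) }. Then (min{1, A²}/2)·m·( ∫₀¹ (u−v)² dx + ∫₀¹ (ρ−r)² dx ) ≤ H_r(ρ,u | r,v). -/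
open MeasureTheory

/-- The second-order Taylor bound for `ξ ↦ ξ log ξ - ξ + 1`. -/
lemma sq_sub_div_two_max_le {a b : ℝ} (ha : 0 < a) (hb : 0 < b) :
    (a - b) ^ 2 / (2 * max a b) ≤ a * Real.log (a / b) - (a - b) := by
  rcases le_total b a with h | h
  · rw [max_eq_left h]
    have hy0 : 0 ≤ 1 - b / a := sub_nonneg.2 ((div_le_one ha).2 h)
    have hy1 : 1 - b / a < 1 := by linarith [div_pos hb ha]
    have hs := Real.hasSum_pow_div_log_of_abs_lt_one (abs_lt.2 ⟨by linarith, hy1⟩)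
    have hle := sum_le_hasSum (Finset.range 2) (fun i _ => by positivity) hs
    have hlog : -Real.log (1 - (1 - b / a)) = Real.log (a / b) := by
      rw [sub_sub_cancel, ← Real.log_inv, inv_div]
    rw [hlog] at hle
    norm_num [Finset.sum_range_succ] at hle
    have hmul := mul_le_mul_of_nonneg_left hle ha.le
    have heq : a * (1 - b / a + (1 - b / a) ^ 2 / 2) = (a - b) + (a - b) ^ 2 / (2 * a) := by
      field_simp
    linarith
  · rw [max_eq_right h]
    have hsinh := Real.self_le_sinh_iff.2 (Real.log_nonneg ((one_le_div ha).2 h))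
    rw [Real.sinh_log (div_pos hb ha), inv_div] at hsinh
    have hlog : Real.log (a / b) = -Real.log (b / a) := by rw [← Real.log_inv, inv_div]
    have hmul := mul_le_mul_of_nonneg_left hsinh ha.le
    have heq : a * ((b / a - a / b) / 2) = -(a - b) - (a - b) ^ 2 / (2 * b) := by
      field_simp
      ring
    rw [hlog]
    linarith

/-- Pointwise lower bound for the relative entropy density. -/
lemma relative_entropy_density_lower_bound {A a b m w : ℝ} (ha : 0 < a) (hb : 0 < b)
    (hm0 : 0 ≤ m) (hma : m ≤ a) (hmax : m ≤ 1 / max a b) :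
    min 1 (A ^ 2) / 2 * m * (w ^ 2 + (a - b) ^ 2) ≤
      (1 / 2) * a * w ^ 2 + A ^ 2 * a * Real.log (a / b) - A ^ 2 * (a - b) := by
  have hkin : min 1 (A ^ 2) * m ≤ a :=
    (mul_le_of_le_one_left hm0 (min_le_left _ _)).trans hma
  have hpot : min 1 (A ^ 2) * m ≤ A ^ 2 * (1 / max a b) :=
    mul_le_mul (min_le_right _ _) hmax hm0 (sq_nonneg A)
  have htaylor := mul_le_mul_of_nonneg_left (sq_sub_div_two_max_le ha hb) (sq_nonneg A)
  have hw := mul_le_mul_of_nonneg_right hkin (sq_nonneg w)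
  have hd := mul_le_mul_of_nonneg_right hpot (sq_nonneg (a - b))
  have heq : A ^ 2 * (1 / max a b) * (a - b) ^ 2 =
      2 * (A ^ 2 * ((a - b) ^ 2 / (2 * max a b))) := by
    have : max a b ≠ 0 := (lt_max_of_lt_left ha).ne'
    field_simp
  linarith

/-- Lower bound for the relative entropy
`H_r(ρ,u | r,v) = ∫₀¹ (½ ρ (u−v)² + A² ρ log(ρ/r)) dx`, with
`m = min{inf ρ, 1/max(sup ρ, sup r)}`. -/
theorem relative_entropy_lower_bound (A : ℝ) (hA : 0 < A) (ρ r u v : ℝ → ℝ)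
    (hρc : ContinuousOn ρ (Set.Icc (0:ℝ) 1))
    (hrc : ContinuousOn r (Set.Icc (0:ℝ) 1))
    (hρpos : ∀ x ∈ Set.Icc (0:ℝ) 1, 0 < ρ x)
    (hrpos : ∀ x ∈ Set.Icc (0:ℝ) 1, 0 < r x)
    (hmassρ : ∫ x in (0:ℝ)..1, ρ x = 1)
    (hmassr : ∫ x in (0:ℝ)..1, r x = 1)
    (huc : ContinuousOn u (Set.Icc (0:ℝ) 1))
    (hvc : ContinuousOn v (Set.Icc (0:ℝ) 1))
    (m : ℝ)
    (hm : m = min (⨅ x : Set.Icc (0:ℝ) 1, ρ ↑x)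
        (1 / max (⨆ x : Set.Icc (0:ℝ) 1, ρ ↑x) (⨆ x : Set.Icc (0:ℝ) 1, r ↑x))) :
    min 1 (A ^ 2) / 2 * m *
        ((∫ x in (0:ℝ)..1, (u x - v x) ^ 2) + ∫ x in (0:ℝ)..1, (ρ x - r x) ^ 2) ≤
      ∫ x in (0:ℝ)..1,
        ((1 / 2) * ρ x * (u x - v x) ^ 2 + A ^ 2 * ρ x * Real.log (ρ x / r x)) := by
  have bdd {f : ℝ → ℝ} (hf : ContinuousOn f (Set.Icc (0:ℝ) 1)) :
      BddBelow (Set.range fun x : Set.Icc (0:ℝ) 1 => f x) ∧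
        BddAbove (Set.range fun x : Set.Icc (0:ℝ) 1 => f x) :=
    have hc := isCompact_range (continuousOn_iff_continuous_domRestrict.1 hf)
    ⟨hc.bddBelow, hc.bddAbove⟩
  have int {f : ℝ → ℝ} (hf : ContinuousOn f (Set.Icc (0:ℝ) 1)) :
      IntervalIntegrable f volume 0 1 :=
    hf.intervalIntegrable_of_Icc zero_le_one
  have hm0 : 0 ≤ m := by
    rw [hm]
    refine le_min (Real.iInf_nonneg fun x => (hρpos x x.2).le) (one_div_nonneg.2 ?_)
    exact le_max_of_le_left (Real.iSup_nonneg fun x => (hρpos x x.2).le)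
  have hmρ (x) (hx : x ∈ Set.Icc (0:ℝ) 1) : m ≤ ρ x :=
    hm.le.trans ((min_le_left _ _).trans (ciInf_le (bdd hρc).1 ⟨x, hx⟩))
  have hmmax (x) (hx : x ∈ Set.Icc (0:ℝ) 1) : m ≤ 1 / max (ρ x) (r x) :=
    hm.le.trans ((min_le_right _ _).trans (one_div_le_one_div_of_le
      (lt_max_of_lt_left (hρpos x hx))
      (max_le_max (le_ciSup (bdd hρc).2 ⟨x, hx⟩) (le_ciSup (bdd hrc).2 ⟨x, hx⟩))))
  have hw : ContinuousOn (fun x => (u x - v x) ^ 2) (Set.Icc (0:ℝ) 1) :=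
    (huc.sub hvc).pow 2
  have hd : ContinuousOn (fun x => (ρ x - r x) ^ 2) (Set.Icc (0:ℝ) 1) :=
    (hρc.sub hrc).pow 2
  have hlog : ContinuousOn (fun x => Real.log (ρ x / r x)) (Set.Icc (0:ℝ) 1) :=
    (hρc.div hrc fun x hx => (hrpos x hx).ne').log
      fun x hx => (div_pos (hρpos x hx) (hrpos x hx)).ne'
  have hH : ContinuousOn (fun x => (1 / 2) * ρ x * (u x - v x) ^ 2 +
      A ^ 2 * ρ x * Real.log (ρ x / r x)) (Set.Icc (0:ℝ) 1) :=
    ((continuousOn_const.mul hρc).mul hw).add ((continuousOn_const.mul hρc).mul hlog)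
  have hmass : ContinuousOn (fun x => A ^ 2 * (ρ x - r x)) (Set.Icc (0:ℝ) 1) :=
    continuousOn_const.mul (hρc.sub hrc)
  have hmass_zero : ∫ x in (0:ℝ)..1, A ^ 2 * (ρ x - r x) = 0 := by
    rw [intervalIntegral.integral_const_mul,
      intervalIntegral.integral_sub (int hρc) (int hrc), hmassρ, hmassr, sub_self, mul_zero]
  have hsub := intervalIntegral.integral_sub (int hH) (int hmass)
  rw [hmass_zero, sub_zero] at hsub
  rw [← intervalIntegral.integral_add (int hw) (int hd), ← intervalIntegral.integral_const_mul,
    ← hsub]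
  exact intervalIntegral.integral_mono_on zero_le_one
    (int (continuousOn_const.mul (hw.add hd))) (int (hH.sub hmass)) fun x hx =>
      relative_entropy_density_lower_bound (hρpos x hx) (hrpos x hx) hm0 (hmρ x hx) (hmmax x hx)
end

section
/- Let ρ, r : [0,1] → ℝ be continuous with ρ(x) > 0 and r(x) > 0 for all x, ∫₀¹ ρ dx = ∫₀¹ r dx = 1, let u, v : [0,1] → ℝ be continuous, and let A > 0. Then H_r(ρ,u | r,v) ≤ ½ (sup_{x} ρ(x)) ∫₀¹ (u−v)² dx + (A²/2)·max( sup_{x} 1/ρ(x), sup_{x} 1/r(x) ) ∫₀¹ (ρ−r)² dx. -/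
open MeasureTheory

/-- Quadratic Taylor bound for `ξ ↦ ξ log ξ`, with remainder controlled by `max a⁻¹ b⁻¹`. -/
theorem mul_log_div_sub_le {a b : ℝ} (ha : 0 < a) (hb : 0 < b) :
    a * Real.log (a / b) - (a - b) ≤ 1 / 2 * max (1 / a) (1 / b) * (a - b) ^ 2 := by
  rcases le_total b a with h | h
  · have hlog : Real.log (a / b) ≤ (a / b - (a / b)⁻¹) / 2 := by
      rw [← Real.sinh_log (by positivity)]
      exact Real.self_le_sinh_iff.2 (Real.log_nonneg ((one_le_div hb).2 h))
    calc a * Real.log (a / b) - (a - b)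
        ≤ a * ((a / b - (a / b)⁻¹) / 2) - (a - b) := by gcongr
      _ = 1 / 2 * (1 / b) * (a - b) ^ 2 := by field_simp; ring
      _ ≤ _ := by gcongr; exact le_max_right _ _
  · have hx : 0 ≤ (b - a) / a := div_nonneg (sub_nonneg.2 h) ha.le
    have hlog := Real.le_log_one_add_of_nonneg hx
    have heq : 1 + (b - a) / a = (a / b)⁻¹ := by field_simp; ring
    rw [heq, Real.log_inv] at hlog
    have hlow : (b - a) / a - ((b - a) / a) ^ 2 / 2 ≤
        2 * ((b - a) / a) / ((b - a) / a + 2) := by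
      rw [le_div_iff₀ (by positivity)]
      nlinarith [pow_nonneg hx 3]
    calc a * Real.log (a / b) - (a - b)
        ≤ a * (((b - a) / a) ^ 2 / 2 - (b - a) / a) - (a - b) := by
          gcongr
          linarith
      _ = 1 / 2 * (1 / a) * (a - b) ^ 2 := by field_simp; ring
      _ ≤ _ := by gcongr; exact le_max_left _ _

/-- A continuous function on a compact set is bounded by its supremum there. -/
theorem ContinuousOn.le_ciSup_of_isCompact {X : Type*} [TopologicalSpace X] {f : X → ℝ}
    {s : Set X} (hf : ContinuousOn f s) (hs : IsCompact s) {x : X} (hx : x ∈ s) :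
    f x ≤ ⨆ y : s, f y := by
  refine le_ciSup (f := fun y : s => f y) ?_ ⟨x, hx⟩
  rw [← Set.image_eq_range]
  exact hs.bddAbove_image hf

/-- Upper bound for the relative entropy
`H_r(ρ,u | r,v) ≤ ½ (sup ρ) ∫₀¹ (u−v)² + (A²/2)·max(sup ρ⁻¹, sup r⁻¹) ∫₀¹ (ρ−r)²`. -/
theorem relative_entropy_upper_bound (A : ℝ) (hA : 0 < A) (ρ r u v : ℝ → ℝ)
    (hρc : ContinuousOn ρ (Set.Icc (0:ℝ) 1))
    (hrc : ContinuousOn r (Set.Icc (0:ℝ) 1))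
    (hρpos : ∀ x ∈ Set.Icc (0:ℝ) 1, 0 < ρ x)
    (hrpos : ∀ x ∈ Set.Icc (0:ℝ) 1, 0 < r x)
    (hmassρ : ∫ x in (0:ℝ)..1, ρ x = 1)
    (hmassr : ∫ x in (0:ℝ)..1, r x = 1)
    (huc : ContinuousOn u (Set.Icc (0:ℝ) 1))
    (hvc : ContinuousOn v (Set.Icc (0:ℝ) 1)) :
    (∫ x in (0:ℝ)..1,
        ((1 / 2) * ρ x * (u x - v x) ^ 2 + A ^ 2 * ρ x * Real.log (ρ x / r x))) ≤
      (1 / 2) * (⨆ x : Set.Icc (0:ℝ) 1, ρ ↑x) * (∫ x in (0:ℝ)..1, (u x - v x) ^ 2) +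
        A ^ 2 / 2 *
          max (⨆ x : Set.Icc (0:ℝ) 1, 1 / ρ ↑x) (⨆ x : Set.Icc (0:ℝ) 1, 1 / r ↑x) *
          ∫ x in (0:ℝ)..1, (ρ x - r x) ^ 2 := by
  set M := ⨆ x : Set.Icc (0:ℝ) 1, ρ ↑x
  set K := max (⨆ x : Set.Icc (0:ℝ) 1, 1 / ρ ↑x) (⨆ x : Set.Icc (0:ℝ) 1, 1 / r ↑x)
  have hρ0 : ∀ x ∈ Set.Icc (0:ℝ) 1, ρ x ≠ 0 := fun x hx => (hρpos x hx).ne'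
  have hr0 : ∀ x ∈ Set.Icc (0:ℝ) 1, r x ≠ 0 := fun x hx => (hrpos x hx).ne'
  have hpt : ∀ x ∈ Set.Icc (0:ℝ) 1,
      (1 / 2) * ρ x * (u x - v x) ^ 2 + A ^ 2 * ρ x * Real.log (ρ x / r x) ≤
        1 / 2 * M * (u x - v x) ^ 2 + A ^ 2 * (ρ x - r x) +
          A ^ 2 / 2 * K * (ρ x - r x) ^ 2 := by
    intro x hx
    have hρM : ρ x ≤ M := hρc.le_ciSup_of_isCompact isCompact_Icc hx
    have hmax : max (1 / ρ x) (1 / r x) ≤ K := max_le_max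
      ((continuousOn_const.div hρc hρ0).le_ciSup_of_isCompact isCompact_Icc hx)
      ((continuousOn_const.div hrc hr0).le_ciSup_of_isCompact isCompact_Icc hx)
    have hkin : 1 / 2 * ρ x * (u x - v x) ^ 2 ≤ 1 / 2 * M * (u x - v x) ^ 2 := by gcongr
    have hlog : ρ x * Real.log (ρ x / r x) - (ρ x - r x) ≤ 1 / 2 * K * (ρ x - r x) ^ 2 :=
      (mul_log_div_sub_le (hρpos x hx) (hrpos x hx)).trans (by gcongr)
    linarith [mul_le_mul_of_nonneg_left hlog (sq_nonneg A)]
  have hint : ∀ f : ℝ → ℝ, ContinuousOn f (Set.Icc (0:ℝ) 1) →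
      IntervalIntegrable f volume 0 1 :=
    fun f hf => hf.intervalIntegrable_of_Icc zero_le_one
  have hkin := (hint _ ((huc.sub hvc).pow 2)).const_mul (1 / 2 * M)
  have hlin := ((hint _ hρc).sub (hint _ hrc)).const_mul (A ^ 2)
  have hquad := (hint _ ((hρc.sub hrc).pow 2)).const_mul (A ^ 2 / 2 * K)
  have hlhs : IntervalIntegrable (fun x =>
      (1 / 2) * ρ x * (u x - v x) ^ 2 + A ^ 2 * ρ x * Real.log (ρ x / r x)) volume 0 1 :=
    hint _ (((continuousOn_const.mul hρc).mul ((huc.sub hvc).pow 2)).add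
      ((continuousOn_const.mul hρc).mul ((hρc.div hrc hr0).log
        fun x hx => div_ne_zero (hρ0 x hx) (hr0 x hx))))
  refine (intervalIntegral.integral_mono_on zero_le_one hlhs
    ((hkin.add hlin).add hquad) hpt).trans_eq ?_
  rw [intervalIntegral.integral_add (hkin.add hlin) hquad,
    intervalIntegral.integral_add hkin hlin, intervalIntegral.integral_const_mul,
    intervalIntegral.integral_const_mul, intervalIntegral.integral_const_mul,
    intervalIntegral.integral_sub (hint _ hρc) (hint _ hrc), hmassρ, hmassr]
  simp only [Pi.pow_apply, Pi.sub_apply]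
  ring
end

section
/- Let T > 0 and let ρ, r : [0,T] × [0,1] → ℝ and u, v : [0,T] × [0,1] → ℝ be continuously differentiable with continuous second mixed partial derivatives, with ρ(t,x) > 0 and r(t,x) > 0 everywhere, satisfying the continuity equations ∂_t ρ + ∂_x(ρ u) = 0 and ∂_t r + ∂_x(r v) = 0 on [0,T] × [0,1], together with the boundary conditions u(t,0) = u(t,1) = v(t,0) = v(t,1) = 0 for all t. Then for every t ∈ (0,T), d/dt ∫₀¹ ρ(t,x)·log( ρ(t,x)/r(t,x) ) dx = ∫₀¹ ρ(t,x)·( u(t,x) − v(t,x) )·∂_x[ log( ρ(t,x)/r(t,x) ) ] dx. -/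
open MeasureTheory

/-- Differentiation under the integral sign for an integrand whose time derivative is continuous on
a closed rectangle. -/
theorem hasDerivAt_intervalIntegral_of_continuousOn_rect {T a b : ℝ} (hab : a ≤ b)
    {F F' : ℝ → ℝ → ℝ}
    (hF : ContinuousOn (fun p : ℝ × ℝ => F p.1 p.2) (Set.Icc 0 T ×ˢ Set.Icc a b))
    (hF' : ContinuousOn (fun p : ℝ × ℝ => F' p.1 p.2) (Set.Icc 0 T ×ˢ Set.Icc a b))
    (hderiv : ∀ t ∈ Set.Icc 0 T, ∀ x ∈ Set.Icc a b, HasDerivAt (fun s => F s x) (F' t x) t)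
    {t : ℝ} (ht : t ∈ Set.Ioo 0 T) :
    HasDerivAt (fun s => ∫ x in a..b, F s x) (∫ x in a..b, F' t x) t := by
  obtain ⟨C, hC⟩ := (isCompact_Icc.prod isCompact_Icc).exists_bound_of_continuousOn hF'
  have slice : ∀ {G : ℝ → ℝ → ℝ},
      ContinuousOn (fun p : ℝ × ℝ => G p.1 p.2) (Set.Icc 0 T ×ˢ Set.Icc a b) →
      ∀ s ∈ Set.Icc 0 T, IntervalIntegrable (G s) volume a b := by
    intro G hG s hs
    refine ContinuousOn.intervalIntegrable_of_Icc hab ?_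
    exact hG.comp (f := fun x => (s, x)) (by fun_prop) fun x hx => ⟨hs, hx⟩
  have hI : Set.uIoc a b ⊆ Set.Icc a b := by
    rw [Set.uIoc_of_le hab]
    exact Set.Ioc_subset_Icc_self
  have hnhds : Set.Ioo 0 T ∈ nhds t := Ioo_mem_nhds ht.1 ht.2
  refine (intervalIntegral.hasDerivAt_integral_of_dominated_loc_of_deriv_le
    (bound := fun _ => C) hnhds ?_ (slice hF t (Set.Ioo_subset_Icc_self ht))
    (slice hF' t (Set.Ioo_subset_Icc_self ht)).def'.aestronglyMeasurable ?_ (by simp) ?_).2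
  · filter_upwards [hnhds] with s hs
    exact (slice hF s (Set.Ioo_subset_Icc_self hs)).def'.aestronglyMeasurable
  · exact .of_forall fun x hx s hs => hC (s, x) ⟨Set.Ioo_subset_Icc_self hs, hI hx⟩
  · exact .of_forall fun x hx s hs => hderiv s (Set.Ioo_subset_Icc_self hs) x (hI hx)

theorem HasDerivAt.log_div {f g : ℝ → ℝ} {f' g' x : ℝ} (hf : HasDerivAt f f' x)
    (hg : HasDerivAt g g' x) (hfx : f x ≠ 0) (hgx : g x ≠ 0) :
    HasDerivAt (fun y => Real.log (f y / g y)) (f' / f x - g' / g x) x := by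
  convert (hf.fun_div hg hgx).log (div_ne_zero hfx hgx) using 1
  field_simp

/-- For positive `C¹` solutions `(ρ,u)` and `(r,v)` (with continuous second mixed
partials) of the continuity equations `∂ₜρ + ∂ₓ(ρu) = 0` and `∂ₜr + ∂ₓ(rv) = 0` on
`[0,T]×[0,1]`, with `u` and `v` vanishing on the spatial boundary, one has for every
`t ∈ (0,T)`:
`d/dt ∫₀¹ ρ log(ρ/r) dx = ∫₀¹ ρ (u − v) ∂ₓ[log(ρ/r)] dx`,
where `∂ₓ[log(ρ/r)] = ∂ₓρ/ρ − ∂ₓr/r`. -/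
theorem relative_entropy_evolution (T : ℝ) (hT : 0 < T)
    (ρ r u v : ℝ → ℝ → ℝ)
    (ρt ρx rt rx ut ux vt vx : ℝ → ℝ → ℝ)
    (ρtx rtx utx vtx : ℝ → ℝ → ℝ)
    -- joint continuity on [0,T]×[0,1]
    (hρc : ContinuousOn (fun p : ℝ × ℝ => ρ p.1 p.2) (Set.Icc 0 T ×ˢ Set.Icc (0:ℝ) 1))
    (hrc : ContinuousOn (fun p : ℝ × ℝ => r p.1 p.2) (Set.Icc 0 T ×ˢ Set.Icc (0:ℝ) 1))
    (huc : ContinuousOn (fun p : ℝ × ℝ => u p.1 p.2) (Set.Icc 0 T ×ˢ Set.Icc (0:ℝ) 1))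
    (hvc : ContinuousOn (fun p : ℝ × ℝ => v p.1 p.2) (Set.Icc 0 T ×ˢ Set.Icc (0:ℝ) 1))
    -- first partial derivatives
    (hρt : ∀ t ∈ Set.Icc 0 T, ∀ x ∈ Set.Icc (0:ℝ) 1,
      HasDerivAt (fun s => ρ s x) (ρt t x) t)
    (hρx : ∀ t ∈ Set.Icc 0 T, ∀ x ∈ Set.Icc (0:ℝ) 1,
      HasDerivAt (fun y => ρ t y) (ρx t x) x)
    (hrt : ∀ t ∈ Set.Icc 0 T, ∀ x ∈ Set.Icc (0:ℝ) 1,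
      HasDerivAt (fun s => r s x) (rt t x) t)
    (hrx : ∀ t ∈ Set.Icc 0 T, ∀ x ∈ Set.Icc (0:ℝ) 1,
      HasDerivAt (fun y => r t y) (rx t x) x)
    (hut : ∀ t ∈ Set.Icc 0 T, ∀ x ∈ Set.Icc (0:ℝ) 1,
      HasDerivAt (fun s => u s x) (ut t x) t)
    (hux : ∀ t ∈ Set.Icc 0 T, ∀ x ∈ Set.Icc (0:ℝ) 1,
      HasDerivAt (fun y => u t y) (ux t x) x)
    (hvt : ∀ t ∈ Set.Icc 0 T, ∀ x ∈ Set.Icc (0:ℝ) 1,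
      HasDerivAt (fun s => v s x) (vt t x) t)
    (hvx : ∀ t ∈ Set.Icc 0 T, ∀ x ∈ Set.Icc (0:ℝ) 1,
      HasDerivAt (fun y => v t y) (vx t x) x)
    -- continuity of the first partial derivatives
    (hρtc : ContinuousOn (fun p : ℝ × ℝ => ρt p.1 p.2) (Set.Icc 0 T ×ˢ Set.Icc (0:ℝ) 1))
    (hρxc : ContinuousOn (fun p : ℝ × ℝ => ρx p.1 p.2) (Set.Icc 0 T ×ˢ Set.Icc (0:ℝ) 1))
    (hrtc : ContinuousOn (fun p : ℝ × ℝ => rt p.1 p.2) (Set.Icc 0 T ×ˢ Set.Icc (0:ℝ) 1))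
    (hrxc : ContinuousOn (fun p : ℝ × ℝ => rx p.1 p.2) (Set.Icc 0 T ×ˢ Set.Icc (0:ℝ) 1))
    (hutc : ContinuousOn (fun p : ℝ × ℝ => ut p.1 p.2) (Set.Icc 0 T ×ˢ Set.Icc (0:ℝ) 1))
    (huxc : ContinuousOn (fun p : ℝ × ℝ => ux p.1 p.2) (Set.Icc 0 T ×ˢ Set.Icc (0:ℝ) 1))
    (hvtc : ContinuousOn (fun p : ℝ × ℝ => vt p.1 p.2) (Set.Icc 0 T ×ˢ Set.Icc (0:ℝ) 1))
    (hvxc : ContinuousOn (fun p : ℝ × ℝ => vx p.1 p.2) (Set.Icc 0 T ×ˢ Set.Icc (0:ℝ) 1))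
    -- continuous second mixed partial derivatives
    (hρtx : ∀ t ∈ Set.Icc 0 T, ∀ x ∈ Set.Icc (0:ℝ) 1,
      HasDerivAt (fun s => ρx s x) (ρtx t x) t)
    (hrtx : ∀ t ∈ Set.Icc 0 T, ∀ x ∈ Set.Icc (0:ℝ) 1,
      HasDerivAt (fun s => rx s x) (rtx t x) t)
    (hutx : ∀ t ∈ Set.Icc 0 T, ∀ x ∈ Set.Icc (0:ℝ) 1,
      HasDerivAt (fun s => ux s x) (utx t x) t)
    (hvtx : ∀ t ∈ Set.Icc 0 T, ∀ x ∈ Set.Icc (0:ℝ) 1,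
      HasDerivAt (fun s => vx s x) (vtx t x) t)
    (hρtxc : ContinuousOn (fun p : ℝ × ℝ => ρtx p.1 p.2) (Set.Icc 0 T ×ˢ Set.Icc (0:ℝ) 1))
    (hrtxc : ContinuousOn (fun p : ℝ × ℝ => rtx p.1 p.2) (Set.Icc 0 T ×ˢ Set.Icc (0:ℝ) 1))
    (hutxc : ContinuousOn (fun p : ℝ × ℝ => utx p.1 p.2) (Set.Icc 0 T ×ˢ Set.Icc (0:ℝ) 1))
    (hvtxc : ContinuousOn (fun p : ℝ × ℝ => vtx p.1 p.2) (Set.Icc 0 T ×ˢ Set.Icc (0:ℝ) 1))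
    -- positivity of the densities
    (hρpos : ∀ t ∈ Set.Icc 0 T, ∀ x ∈ Set.Icc (0:ℝ) 1, 0 < ρ t x)
    (hrpos : ∀ t ∈ Set.Icc 0 T, ∀ x ∈ Set.Icc (0:ℝ) 1, 0 < r t x)
    -- continuity equations ∂ₜρ + ∂ₓ(ρu) = 0 and ∂ₜr + ∂ₓ(rv) = 0
    (heqρ : ∀ t ∈ Set.Icc 0 T, ∀ x ∈ Set.Icc (0:ℝ) 1,
      ρt t x + (ρx t x * u t x + ρ t x * ux t x) = 0)
    (heqr : ∀ t ∈ Set.Icc 0 T, ∀ x ∈ Set.Icc (0:ℝ) 1,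
      rt t x + (rx t x * v t x + r t x * vx t x) = 0)
    -- boundary conditions
    (hbd : ∀ t ∈ Set.Icc 0 T, u t 0 = 0 ∧ u t 1 = 0 ∧ v t 0 = 0 ∧ v t 1 = 0) :
    ∀ t ∈ Set.Ioo 0 T,
      HasDerivAt (fun s => ∫ x in (0:ℝ)..1, ρ s x * Real.log (ρ s x / r s x))
        (∫ x in (0:ℝ)..1,
          ρ t x * (u t x - v t x) * (ρx t x / ρ t x - rx t x / r t x)) t := by
  intro t ht
  have ht' : t ∈ Set.Icc 0 T := Set.Ioo_subset_Icc_self ht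
  have hρne : ∀ p ∈ Set.Icc 0 T ×ˢ Set.Icc (0:ℝ) 1, ρ p.1 p.2 ≠ 0 :=
    fun p hp => (hρpos p.1 hp.1 p.2 hp.2).ne'
  have hrne : ∀ p ∈ Set.Icc 0 T ×ˢ Set.Icc (0:ℝ) 1, r p.1 p.2 ≠ 0 :=
    fun p hp => (hrpos p.1 hp.1 p.2 hp.2).ne'
  have hLc : ContinuousOn (fun p : ℝ × ℝ => Real.log (ρ p.1 p.2 / r p.1 p.2))
      (Set.Icc 0 T ×ˢ Set.Icc (0:ℝ) 1) :=
    (hρc.div hrc hrne).log fun p hp => div_ne_zero (hρne p hp) (hrne p hp)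
  have hDc : ContinuousOn
      (fun p : ℝ × ℝ => ρt p.1 p.2 * Real.log (ρ p.1 p.2 / r p.1 p.2)
        + ρ p.1 p.2 * (ρt p.1 p.2 / ρ p.1 p.2 - rt p.1 p.2 / r p.1 p.2))
      (Set.Icc 0 T ×ˢ Set.Icc (0:ℝ) 1) :=
    (hρtc.mul hLc).add (hρc.mul ((hρtc.div hρc hρne).sub (hrtc.div hrc hrne)))
  have hRc : ContinuousOn
      (fun p : ℝ × ℝ => ρ p.1 p.2 * (u p.1 p.2 - v p.1 p.2)
        * (ρx p.1 p.2 / ρ p.1 p.2 - rx p.1 p.2 / r p.1 p.2))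
      (Set.Icc 0 T ×ˢ Set.Icc (0:ℝ) 1) :=
    (hρc.mul (huc.sub hvc)).mul ((hρxc.div hρc hρne).sub (hrxc.div hrc hrne))
  have slice : ∀ {G : ℝ → ℝ → ℝ},
      ContinuousOn (fun p : ℝ × ℝ => G p.1 p.2) (Set.Icc 0 T ×ˢ Set.Icc (0:ℝ) 1) →
      IntervalIntegrable (G t) volume 0 1 := fun hG =>
    ContinuousOn.intervalIntegrable_of_Icc zero_le_one
      (hG.comp (f := fun x => (t, x)) (by fun_prop) fun x hx => ⟨ht', hx⟩)
  have hRi := slice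
    (G := fun t x => ρ t x * (u t x - v t x) * (ρx t x / ρ t x - rx t x / r t x)) hRc
  have hDi := slice (G := fun t x => ρt t x * Real.log (ρ t x / r t x)
        + ρ t x * (ρt t x / ρ t x - rt t x / r t x)) hDc
  have hleib := hasDerivAt_intervalIntegral_of_continuousOn_rect zero_le_one
    (F := fun s x => ρ s x * Real.log (ρ s x / r s x))
    (F' := fun s x => ρt s x * Real.log (ρ s x / r s x)
        + ρ s x * (ρt s x / ρ s x - rt s x / r s x))
    (hρc.mul hLc) hDc
    (fun s hs x hx => (hρt s hs x hx).fun_mul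
      ((hρt s hs x hx).log_div (hrt s hs x hx) (hρne (s, x) ⟨hs, hx⟩) (hrne (s, x) ⟨hs, hx⟩))) ht
  have hflux := intervalIntegral.integral_eq_sub_of_hasDerivAt
    (f := fun x => ρ t x * u t x * Real.log (ρ t x / r t x) + ρ t x * u t x - ρ t x * v t x)
    (fun x hx => by
      rw [Set.uIcc_of_le zero_le_one] at hx
      have hne := hρne (t, x) ⟨ht', hx⟩
      have hne' := hrne (t, x) ⟨ht', hx⟩
      have hρu := (hρx t ht' x hx).fun_mul (hux t ht' x hx)
      have hρv := (hρx t ht' x hx).fun_mul (hvx t ht' x hx)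
      have hL := (hρx t ht' x hx).log_div (hrx t ht' x hx) hne hne'
      refine (((hρu.fun_mul hL).fun_add hρu).fun_sub hρv).congr_deriv ?_
      have hρt_eq := eq_neg_of_add_eq_zero_left (heqρ t ht' x hx)
      have hrt_eq := eq_neg_of_add_eq_zero_left (heqr t ht' x hx)
      simp only [hρt_eq, hrt_eq]
      field_simp
      ring) (hRi.sub hDi)
  rw [intervalIntegral.integral_sub hRi hDi] at hflux
  obtain ⟨hu0, hu1, hv0, hv1⟩ := hbd t ht'
  simp only [hu0, hu1, hv0, hv1, mul_zero, zero_mul, add_zero, sub_zero] at hflux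
  exact hleib.congr_deriv (sub_eq_zero.mp hflux).symm
end
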